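/- For the one-dimensional energy per site e_s(h) = τ/h + (2/h)∫₀^∞ μ_v(α) · e^{-α}/(1-e^{-α})² · (1 - tanh(αh/2)) dα of a periodic striped configuration of width h, with τ < 0, one has the asymptotic expansion e_s(h) = τ/h + A_p/h^{p-2} + O(h^{-p}) as h → ∞, for a suitable constant A_p > 0 depending only on p. -/

import Mathlib

open Filter Asymptotics

open MeasureTheory Set Real Topology

/-- If the Laplace transform of `f` decays like `exp (-x)`, then `f` vanishes on average on every
initial segment of `(0, 1)`, by Phragmén's inversion formula. -/
theorem setIntegral_Ioo_eq_zero_of_laplace_le {f : ℝ → ℝ} {K : ℝ}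
    (hf : ∀ x : ℝ, 0 < x → IntegrableOn (fun α => f α * exp (-α * x)) (Ioi 0))
    (hK : ∀ x : ℝ, 1 ≤ x → |∫ α in Ioi (0 : ℝ), f α * exp (-α * x)| ≤ K * exp (-x))
    {s : ℝ} (hs : s < 1) : ∫ α in Ioi (0 : ℝ), (Iio s).indicator f α = 0 := by
  have hK0 : 0 ≤ K := by
    have := (abs_nonneg _).trans (hK 1 le_rfl)
    exact nonneg_of_mul_nonneg_left this (exp_pos _)
  have hf1 : IntegrableOn (fun α => f α * exp (s - α)) (Ioi 0) := by
    refine ((hf 1 one_pos).const_mul (exp s)).congr (ae_of_all _ fun α => ?_)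
    simp only [sub_eq_add_neg, exp_add, mul_one]
    ring
  have hfm : AEStronglyMeasurable f (volume.restrict (Ioi 0)) := by
    have : AEStronglyMeasurable (fun α => (f α * exp (s - α)) * exp (α - s))
        (volume.restrict (Ioi 0)) :=
      hf1.aestronglyMeasurable.mul (by fun_prop)
    refine this.congr (ae_of_all _ fun α => ?_)
    simp only [mul_assoc, ← exp_add]
    simp
  set F : ℕ → ℝ → ℝ := fun n α => f α * (1 - exp (-exp (n * (s - α)))) with hF
  have hlim : Tendsto (fun n => ∫ α in Ioi (0 : ℝ), F n α) atTop
      (𝓝 (∫ α in Ioi (0 : ℝ), (Iio s).indicator f α)) := by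
    refine tendsto_integral_filter_of_dominated_convergence (fun α => ‖f α * exp (s - α)‖)
      (Eventually.of_forall fun n => hfm.mul (by fun_prop)) ?_ hf1.norm ?_
    · filter_upwards [eventually_ge_atTop 1] with n hn
      refine ae_of_all _ fun α => ?_
      simp only [hF, norm_mul]
      refine mul_le_mul_of_nonneg_left ?_ (norm_nonneg _)
      have h1 : 0 ≤ 1 - exp (-exp (n * (s - α))) := by
        simp [exp_nonneg]
      rw [norm_of_nonneg h1, norm_of_nonneg (exp_nonneg _)]
      have hn' : (1 : ℝ) ≤ n := by exact_mod_cast hn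
      rcases le_total α s with h | h
      · have : 1 ≤ exp (s - α) := one_le_exp (by linarith)
        linarith [exp_pos (-exp (n * (s - α)))]
      · have h2 : exp (n * (s - α)) ≤ exp (s - α) := exp_le_exp.2 (by nlinarith)
        linarith [add_one_le_exp (-exp (n * (s - α)))]
    · have hne : ∀ᵐ α ∂(volume.restrict (Ioi (0 : ℝ))), α ≠ s :=
        ae_restrict_of_ae (Measure.ae_ne volume s)
      filter_upwards [hne] with α hα
      have hn := tendsto_natCast_atTop_atTop (R := ℝ)
      rcases lt_or_gt_of_ne hα with h | h
      · rw [indicator_of_mem (mem_Iio.2 h)]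
        have h3 : Tendsto (fun n : ℕ => exp (-exp (n * (s - α)))) atTop (𝓝 0) :=
          tendsto_exp_neg_atTop_nhds_zero.comp
            (tendsto_exp_atTop.comp (hn.atTop_mul_const (sub_pos.2 h)))
        simpa using (h3.const_sub 1).const_mul (f α)
      · rw [indicator_of_notMem (by simpa using h.le)]
        have h3 : Tendsto (fun n : ℕ => exp (-exp (n * (s - α)))) atTop (𝓝 (exp (-0))) :=
          ((continuous_exp.comp continuous_neg).tendsto 0).comp
            (tendsto_exp_atBot.comp (hn.atTop_mul_const_of_neg (sub_neg.2 h)))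
        simpa using (h3.const_sub 1).const_mul (f α)
  have hbound : ∀ n : ℕ, 1 ≤ n →
      |∫ α in Ioi (0 : ℝ), F n α| ≤ K * exp 1 * exp (n * (s - 1)) := by
    intro n hn
    have hn' : (1 : ℝ) ≤ n := by exact_mod_cast hn
    set G : ℕ → ℝ → ℝ := fun k α =>
      ((-1) ^ k / (k + 1).factorial * exp ((k + 1) * n * s)) * (f α * exp (-α * ((k + 1) * n)))
      with hG
    have hkn (k : ℕ) : (1 : ℝ) ≤ (k + 1) * n := by nlinarith [(k.cast_nonneg : (0 : ℝ) ≤ k)]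
    have hGint (k : ℕ) : IntegrableOn (G k) (Ioi 0) :=
      (hf _ (one_pos.trans_le (hkn k))).const_mul _
    have hGF : ∀ α, F n α = ∑' k, G k α := by
      intro α
      have h1 := NormedSpace.expSeries_div_hasSum_exp (𝔸 := ℝ) (-exp (n * (s - α)))
      rw [← Real.exp_eq_exp_ℝ] at h1
      have h2 := (hasSum_nat_add_iff' 1).2 h1
      have h3 := (h2.mul_left (-f α)).tsum_eq
      simp only [Finset.range_one, Finset.sum_singleton, pow_zero, Nat.factorial_zero,
        Nat.cast_one, div_one] at h3
      simp only [hF]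
      rw [show f α * (1 - exp (-exp (n * (s - α)))) = -f α * (exp (-exp (n * (s - α))) - 1) by ring,
        ← h3]
      refine tsum_congr fun k => ?_
      have h4 : exp ((k + 1) * n * s) * exp (-α * ((k + 1) * n))
          = exp (n * (s - α)) ^ (k + 1) := by
        rw [← exp_add, ← exp_nat_mul]
        push_cast
        ring_nf
      simp only [hG]
      rw [neg_pow, ← h4]
      ring
    have hGnorm (k : ℕ) : ∫ α in Ioi (0 : ℝ), ‖G k α‖ ≤
        (exp (n * s) ^ (k + 1) / (k + 1).factorial) * ∫ α in Ioi (0 : ℝ), ‖f α * exp (-α * 1)‖ := by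
      rw [← integral_const_mul]
      refine setIntegral_mono_on (hGint k).norm ((hf 1 one_pos).norm.const_mul _)
        measurableSet_Ioi fun α hα => ?_
      have h5 : exp (-α * ((k + 1) * n)) ≤ exp (-α * 1) :=
        exp_le_exp.2 (by nlinarith [hkn k, mem_Ioi.1 hα])
      simp only [hG, norm_mul, norm_div, norm_pow, norm_neg, norm_one, one_pow, Real.norm_eq_abs,
        abs_exp, Nat.abs_cast]
      rw [← exp_nat_mul, show ((k + 1 : ℕ) : ℝ) * (n * s) = (k + 1) * n * s by push_cast; ring,
        one_div_mul_eq_div]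
      gcongr
    have hsum : HasSum (fun k => ∫ α in Ioi (0 : ℝ), G k α) (∫ α in Ioi (0 : ℝ), F n α) := by
      simp only [hGF]
      refine hasSum_integral_of_summable_integral_norm hGint ?_
      refine Summable.of_nonneg_of_le (fun k => integral_nonneg fun _ => norm_nonneg _) hGnorm ?_
      exact ((summable_nat_add_iff 1).2 (summable_pow_div_factorial (exp (n * s)))).mul_right _
    have hterm (k : ℕ) : ‖∫ α in Ioi (0 : ℝ), G k α‖ ≤
        K * exp (n * (s - 1)) * (1 ^ k / k.factorial) := by
      have h6 : |∫ α in Ioi (0 : ℝ), f α * exp (-α * ((k + 1) * n))| ≤ _ := hK _ (hkn k)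
      simp only [hG, integral_const_mul, norm_mul, norm_div, norm_pow, norm_neg, norm_one, one_pow,
        Real.norm_eq_abs, abs_exp, Nat.abs_cast]
      have h7 : exp ((k + 1) * n * s) * exp (-((k + 1) * n)) ≤ exp (n * (s - 1)) := by
        rw [← exp_add, exp_le_exp]
        have : 0 ≤ (k : ℝ) * (n * (1 - s)) := by
          have := sub_pos.2 hs
          positivity
        nlinarith
      have h8 : (1 : ℝ) / (k + 1).factorial ≤ 1 / k.factorial := by
        gcongr
        exact k.le_succ
      calc _ ≤ 1 / ((k + 1).factorial : ℝ) * exp ((k + 1) * n * s)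
              * (K * exp (-((k + 1) * n))) := by gcongr
        _ = K * (exp ((k + 1) * n * s) * exp (-((k + 1) * n))) * (1 / (k + 1).factorial) := by ring
        _ ≤ _ := by gcongr
    have h9 := NormedSpace.expSeries_div_hasSum_exp (𝔸 := ℝ) 1
    rw [← Real.exp_eq_exp_ℝ] at h9
    have h10 := tsum_of_norm_bounded (h9.mul_left (K * exp (n * (s - 1)))) hterm
    rw [hsum.tsum_eq, Real.norm_eq_abs] at h10
    linarith
  have hzero : Tendsto (fun n => ∫ α in Ioi (0 : ℝ), F n α) atTop (𝓝 0) := by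
    refine squeeze_zero_norm' ?_ (a := fun n : ℕ => K * exp 1 * exp (n * (s - 1))) ?_
    · filter_upwards [eventually_ge_atTop 1] with n hn using hbound n hn
    · have := tendsto_exp_atBot.comp ((tendsto_natCast_atTop_atTop (R := ℝ)).atTop_mul_const_of_neg
        (sub_neg.2 hs))
      simpa using this.const_mul (K * exp 1)
  exact tendsto_nhds_unique hlim hzero

/-- A function whose Laplace transform decays like `exp (-x)` vanishes almost everywhere on
`(0, 1 / 2)`. -/
theorem ae_eq_zero_of_laplace_le {f : ℝ → ℝ} {K : ℝ}
    (hf : ∀ x : ℝ, 0 < x → IntegrableOn (fun α => f α * exp (-α * x)) (Ioi 0))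
    (hK : ∀ x : ℝ, 1 ≤ x → |∫ α in Ioi (0 : ℝ), f α * exp (-α * x)| ≤ K * exp (-x)) :
    ∀ᵐ α : ℝ, α ∈ Ioo (0 : ℝ) (1 / 2) → f α = 0 := by
  have hfi : IntervalIntegrable f volume 0 (1 / 2) := by
    rw [intervalIntegrable_iff_integrableOn_Ioc_of_le (by norm_num)]
    have h1 : IntegrableOn (fun α => f α * exp (-α * 1)) (Icc 0 (1 / 2)) := by
      rw [integrableOn_Icc_iff_integrableOn_Ioc]
      exact (hf 1 one_pos).mono_set Ioc_subset_Ioi_self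
    have h2 := h1.mul_continuousOn (g' := exp) continuous_exp.continuousOn isCompact_Icc
    refine (h2.mono_set Ioc_subset_Icc_self).congr (ae_of_all _ fun α => ?_)
    simp [mul_assoc, ← exp_add]
  filter_upwards [hfi.ae_hasDerivAt_integral] with α hα hmem
  have hd := hα (by rw [uIcc_of_le (by norm_num)]; exact Ioo_subset_Icc_self hmem) 0 (by simp)
  have h0 : (fun x => ∫ t in (0 : ℝ)..x, f t) =ᶠ[𝓝 α] fun _ => 0 := by
    filter_upwards [Ioo_mem_nhds hmem.1 hmem.2] with x hx
    have := setIntegral_Ioo_eq_zero_of_laplace_le hf hK (s := x) (by linarith [hx.2])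
    rwa [integral_indicator measurableSet_Iio, Measure.restrict_restrict measurableSet_Iio,
      inter_comm, Ioi_inter_Iio, ← integral_Ioc_eq_integral_Ioo,
      ← intervalIntegral.integral_of_le hx.1.le] at this
  exact (hd.congr_of_eventuallyEq h0.symm).unique (hasDerivAt_const α 0)

theorem abs_tsum_exp_neg_mul_int_sq_sub_one_le {a : ℝ} (ha : 0 < a) :
    |∑' y : ℤ, exp (-π * a * (y : ℝ) ^ 2) - 1| ≤ 2 / (1 - exp (-π * a)) * exp (-π * a) := by
  have h := norm_jacobiTheta_sub_one_le (τ := Complex.I * a) (by simpa using ha)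
  have h1 : jacobiTheta (Complex.I * a) = ((∑' y : ℤ, exp (-π * a * (y : ℝ) ^ 2) : ℝ) : ℂ) := by
    rw [jacobiTheta, Complex.ofReal_tsum]
    refine tsum_congr fun y => ?_
    push_cast
    congr 1
    linear_combination (π * y ^ 2 * a : ℂ) * Complex.I_sq
  rw [h1, ← Complex.ofReal_one, ← Complex.ofReal_sub, Complex.norm_real] at h
  simpa using h

/-- Poisson summation for the Gaussian, with an explicit error term. -/
theorem abs_tsum_exp_neg_mul_int_sq_sub_le {t : ℝ} (ht : 0 < t) :
    |∑' y : ℤ, exp (-t * (y : ℝ) ^ 2) - √π * t ^ (-(1 / 2) : ℝ)| ≤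
      2 * √π * (t ^ (-(1 / 2) : ℝ) * (1 + t)) * exp (-(1 / t)) := by
  have hπ := pi_gt_three
  have h := Real.tsum_exp_neg_mul_int_sq (a := t / π) (by positivity)
  rw [show -π * (t / π) = -t by field_simp, show -π / (t / π) = -π * (π / t) by field_simp] at h
  have h1 : 1 / (t / π) ^ (1 / 2 : ℝ) = √π * t ^ (-(1 / 2) : ℝ) := by
    rw [div_rpow ht.le pi_pos.le, rpow_neg ht.le, sqrt_eq_rpow, one_div_div, div_eq_mul_inv]
  rw [h, h1]
  have h2 := abs_tsum_exp_neg_mul_int_sq_sub_one_le (a := π / t) (by positivity)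
  set z := π * (π / t) with hz
  have hzt : 1 / t ≤ z := by
    rw [hz, ← mul_div_assoc]
    gcongr
    nlinarith
  have hz0 : 0 < z := by positivity
  have h3 : 2 / (1 - exp (-π * (π / t))) * exp (-π * (π / t)) ≤ 2 * (1 + t) * exp (-(1 / t)) := by
    rw [neg_mul, ← hz]
    have h4 : exp (-z) ≤ exp (-(1 / t)) := exp_le_exp.2 (by linarith)
    have h5 : 2 / (1 - exp (-z)) ≤ 2 * (1 + t) := by
      have h6 : exp (-z) ≤ (1 + z)⁻¹ := by
        rw [exp_neg]
        exact inv_anti₀ (by positivity) (by linarith [add_one_le_exp z])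
      have h7 : (1 + t)⁻¹ ≤ 1 - (1 + z)⁻¹ := by
        have : 1 ≤ t * z := by
          rw [div_le_iff₀ ht] at hzt
          linarith
        have h8 : 1 - (1 + z)⁻¹ = z / (1 + z) := by field_simp; ring
        rw [h8, inv_eq_one_div, div_le_div_iff₀ (by positivity) (by positivity)]
        nlinarith
      rw [div_le_iff₀ (by linarith [inv_pos.2 (by positivity : 0 < 1 + t)])]
      have h9 := mul_le_mul_of_nonneg_left (h7.trans (sub_le_sub_left h6 1))
        (by positivity : 0 ≤ 2 * (1 + t))
      have : 2 * (1 + t) * (1 + t)⁻¹ = 2 := by field_simp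
      linarith
    gcongr
  have ht2 : 0 ≤ t ^ (-(1 / 2) : ℝ) := by positivity
  calc _ = |√π * t ^ (-(1 / 2) : ℝ)| * |∑' y : ℤ, exp (-π * (π / t) * (y : ℝ) ^ 2) - 1| := by
        rw [← abs_mul]
        ring_nf
    _ ≤ √π * t ^ (-(1 / 2) : ℝ) * (2 * (1 + t) * exp (-(1 / t))) := by
        rw [abs_of_nonneg (by positivity)]
        gcongr
        exact h2.trans h3
    _ = _ := by ring

theorem summable_add_int_sq_rpow {p : ℝ} (hp : 1 < p) (x : ℝ) :
    Summable fun y : ℤ => (x ^ 2 + (y : ℝ) ^ 2) ^ (-(p / 2)) := by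
  refine (summable_abs_int_rpow hp).of_norm_bounded_eventually ?_
  filter_upwards [(Set.finite_singleton (0 : ℤ)).compl_mem_cofinite] with y hy
  have hy' : 0 < |(y : ℝ)| := by simpa using hy
  rw [norm_of_nonneg (by positivity), show -p = (2 : ℕ) * (-(p / 2)) by push_cast; ring,
    rpow_mul hy'.le, rpow_natCast, sq_abs]
  exact rpow_le_rpow_of_nonpos (by rw [← sq_abs]; positivity) (by nlinarith) (by linarith)

theorem tsum_add_int_sq_rpow_pos {p x : ℝ} (hp : 1 < p) (hx : 0 < x) :
    0 < ∑' y : ℤ, (x ^ 2 + (y : ℝ) ^ 2) ^ (-(p / 2)) :=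
  (summable_add_int_sq_rpow hp x).tsum_pos (fun _ => by positivity) 0 (by positivity)

theorem integrableOn_rpow_mul_exp_neg_mul {s b : ℝ} (hs : -1 < s) (hb : 0 < b) :
    IntegrableOn (fun t : ℝ => t ^ s * exp (-b * t)) (Ioi 0) := by
  simpa using integrableOn_rpow_mul_exp_neg_mul_rpow hs one_pos hb

theorem integral_rpow_mul_tsum_exp_neg_mul_int_sq {p x : ℝ} (hp : 1 < p) (hx : 0 < x) :
    ∫ t in Ioi (0 : ℝ), t ^ (p / 2 - 1) * exp (-x ^ 2 * t) * ∑' y : ℤ, exp (-t * (y : ℝ) ^ 2)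
      = Gamma (p / 2) * ∑' y : ℤ, (x ^ 2 + (y : ℝ) ^ 2) ^ (-(p / 2)) := by
  have hpos (y : ℤ) : 0 < x ^ 2 + (y : ℝ) ^ 2 := by positivity
  set F : ℤ → ℝ → ℝ := fun y t => t ^ (p / 2 - 1) * exp (-(x ^ 2 + (y : ℝ) ^ 2) * t) with hF
  have hFint (y : ℤ) : IntegrableOn (F y) (Ioi 0) :=
    integrableOn_rpow_mul_exp_neg_mul (by linarith) (hpos y)
  have hFval (y : ℤ) : ∫ t in Ioi (0 : ℝ), F y t
      = Gamma (p / 2) * (x ^ 2 + (y : ℝ) ^ 2) ^ (-(p / 2)) := by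
    have := integral_rpow_mul_exp_neg_mul_Ioi (a := p / 2) (by linarith) (hpos y)
    rw [one_div, inv_rpow (hpos y).le, ← rpow_neg (hpos y).le, mul_comm] at this
    simpa only [hF, neg_mul] using this
  have hsum := integral_tsum_of_summable_integral_norm (F := F) hFint (by
    have (y : ℤ) : ∫ t in Ioi (0 : ℝ), ‖F y t‖ = ∫ t in Ioi (0 : ℝ), F y t :=
      setIntegral_congr_fun measurableSet_Ioi fun t ht => norm_of_nonneg
        (mul_nonneg (rpow_nonneg (le_of_lt ht) _) (exp_nonneg _))
    simp only [this, hFval]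
    exact (summable_add_int_sq_rpow hp x).mul_left _)
  simp only [hFval, tsum_mul_left] at hsum
  rw [hsum]
  congr 1 with t
  rw [← tsum_mul_left]
  refine tsum_congr fun y => ?_
  rw [mul_assoc, ← exp_add]
  simp only [hF]
  ring_nf

/-- The lattice sum `∑ y, (x ^ 2 + y ^ 2) ^ (-p / 2)` agrees with the Laplace transform of a
multiple of `α ^ (p - 2)` up to an exponentially small error. -/
theorem exists_abs_tsum_sub_laplace_le {p : ℝ} (hp : 1 < p) : ∃ c K : ℝ, 0 < c ∧ ∀ x : ℝ, 1 ≤ x →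
    |∑' y : ℤ, (x ^ 2 + (y : ℝ) ^ 2) ^ (-(p / 2))
      - c * ∫ α in Ioi (0 : ℝ), α ^ (p - 2) * exp (-α * x)| ≤ K * exp (-x) := by
  have hΓ : 0 < Gamma (p / 2) := Gamma_pos_of_pos (by linarith)
  have hΓ1 : 0 < Gamma (p - 1) := Gamma_pos_of_pos (by linarith)
  have hΓ2 : 0 < Gamma ((p - 1) / 2) := Gamma_pos_of_pos (by linarith)
  have hπ : 0 < √π := by positivity
  set B : ℝ → ℝ := fun t =>
    2 * √π * (t ^ (p / 2 - 3 / 2) * exp (-(3 / 4) * t) + t ^ (p / 2 - 1 / 2) * exp (-(3 / 4) * t))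
    with hB
  have hBint : IntegrableOn B (Ioi 0) :=
    ((integrableOn_rpow_mul_exp_neg_mul (by linarith) (by norm_num)).add
      (integrableOn_rpow_mul_exp_neg_mul (by linarith) (by norm_num))).const_mul _
  refine ⟨√π * Gamma ((p - 1) / 2) / (Gamma (p / 2) * Gamma (p - 1)),
    (∫ t in Ioi (0 : ℝ), B t) / Gamma (p / 2), by positivity, fun x hx => ?_⟩
  have hx0 : 0 < x := one_pos.trans_le hx
  have h1 : ∫ α in Ioi (0 : ℝ), α ^ (p - 2) * exp (-α * x) = x ^ (1 - p) * Gamma (p - 1) := by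
    have := integral_rpow_mul_exp_neg_mul_Ioi (a := p - 1) (by linarith) hx0
    rw [one_div, inv_rpow hx0.le, ← rpow_neg hx0.le, neg_sub] at this
    rw [← this]
    congr 1 with α
    ring_nf
  have h2 : ∫ t in Ioi (0 : ℝ), t ^ (p / 2 - 3 / 2) * exp (-x ^ 2 * t)
      = x ^ (1 - p) * Gamma ((p - 1) / 2) := by
    have := integral_rpow_mul_exp_neg_mul_Ioi (a := (p - 1) / 2) (by linarith)
      (by positivity : 0 < x ^ 2)
    rw [one_div, inv_rpow (by positivity), ← rpow_neg (by positivity), ← rpow_natCast_mul hx0.le,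
      show ((2 : ℕ) : ℝ) * -((p - 1) / 2) = 1 - p by push_cast; ring] at this
    rw [← this]
    congr 1 with t
    ring_nf
  have h3 := integral_rpow_mul_tsum_exp_neg_mul_int_sq hp hx0
  have hv := tsum_add_int_sq_rpow_pos hp hx0
  have h3i : IntegrableOn (fun t : ℝ =>
      t ^ (p / 2 - 1) * exp (-x ^ 2 * t) * ∑' y : ℤ, exp (-t * (y : ℝ) ^ 2)) (Ioi 0) := by
    by_contra h
    rw [integral_undef h] at h3
    exact (mul_pos hΓ hv).ne h3
  have h2i : IntegrableOn (fun t : ℝ => √π * (t ^ (p / 2 - 3 / 2) * exp (-x ^ 2 * t))) (Ioi 0) :=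
    (integrableOn_rpow_mul_exp_neg_mul (by linarith) (by positivity)).const_mul _
  have h4 : |∫ t in Ioi (0 : ℝ), (t ^ (p / 2 - 1) * exp (-x ^ 2 * t)
      * ∑' y : ℤ, exp (-t * (y : ℝ) ^ 2) - √π * (t ^ (p / 2 - 3 / 2) * exp (-x ^ 2 * t)))| ≤
      ∫ t in Ioi (0 : ℝ), B t * exp (-x) := by
    rw [← Real.norm_eq_abs]
    refine norm_integral_le_of_norm_le (hBint.mul_const _) ?_
    filter_upwards [ae_restrict_mem measurableSet_Ioi] with t ht
    replace ht : 0 < t := ht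
    have e1 : t ^ (p / 2 - 3 / 2) = t ^ (p / 2 - 1) * t ^ (-(1 / 2) : ℝ) := by
      rw [← rpow_add ht]
      ring_nf
    have e2 : t ^ (p / 2 - 1 / 2) = t ^ (p / 2 - 1) * (t ^ (-(1 / 2) : ℝ) * t) := by
      rw [← rpow_add_one ht.ne', ← rpow_add ht]
      ring_nf
    have e3 : exp (-x ^ 2 * t) * exp (-(1 / t)) ≤ exp (-(3 / 4) * t) * exp (-x) := by
      rw [← exp_add, ← exp_add, exp_le_exp]
      have : 0 ≤ (x * t / 2 - 1) ^ 2 / t := by positivity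
      have e4 : (x * t / 2 - 1) ^ 2 / t = x ^ 2 * t / 4 - x + 1 / t := by field_simp; ring
      have : t ≤ x ^ 2 * t := le_mul_of_one_le_left ht.le (one_le_pow₀ hx)
      nlinarith
    rw [e1, show t ^ (p / 2 - 1) * exp (-x ^ 2 * t) * ∑' y : ℤ, exp (-t * (y : ℝ) ^ 2)
      - √π * (t ^ (p / 2 - 1) * t ^ (-(1 / 2) : ℝ) * exp (-x ^ 2 * t))
      = t ^ (p / 2 - 1) * exp (-x ^ 2 * t)
        * (∑' y : ℤ, exp (-t * (y : ℝ) ^ 2) - √π * t ^ (-(1 / 2) : ℝ)) by ring, norm_mul,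
      norm_of_nonneg (by positivity), Real.norm_eq_abs]
    calc _ ≤ t ^ (p / 2 - 1) * exp (-x ^ 2 * t)
          * (2 * √π * (t ^ (-(1 / 2) : ℝ) * (1 + t)) * exp (-(1 / t))) := by
          gcongr
          exact abs_tsum_exp_neg_mul_int_sq_sub_le ht
      _ = t ^ (p / 2 - 1) * (2 * √π * (t ^ (-(1 / 2) : ℝ) * (1 + t)))
          * (exp (-x ^ 2 * t) * exp (-(1 / t))) := by ring
      _ ≤ t ^ (p / 2 - 1) * (2 * √π * (t ^ (-(1 / 2) : ℝ) * (1 + t)))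
          * (exp (-(3 / 4) * t) * exp (-x)) := by gcongr
      _ = _ := by
          simp only [hB, e1, e2]
          ring
  rw [integral_sub h3i h2i, h3, integral_const_mul, h2, integral_mul_const] at h4
  rw [h1, div_mul_eq_mul_div, div_mul_eq_mul_div (∫ t in Ioi (0 : ℝ), B t), le_div_iff₀ hΓ]
  refine le_trans (le_of_eq ?_) h4
  nth_rewrite 2 [← abs_of_pos hΓ]
  rw [← abs_mul]
  congr 1
  field_simp

theorem sinh_le_mul_cosh {y : ℝ} (hy : 0 ≤ y) : sinh y ≤ y * cosh y := by
  have hd (z : ℝ) : HasDerivAt (fun z => z * cosh z - sinh z) (z * sinh z) z := by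
    convert! ((hasDerivAt_id z).mul (hasDerivAt_cosh z)).sub (hasDerivAt_sinh z) using 1
    simp
  have hmono : MonotoneOn (fun z : ℝ => z * cosh z - sinh z) (Ici 0) := by
    refine monotoneOn_of_deriv_nonneg (convex_Ici 0)
      (fun z _ => (hd z).continuousAt.continuousWithinAt)
      (fun z _ => (hd z).differentiableAt.differentiableWithinAt) fun z hz => ?_
    rw [interior_Ici] at hz
    rw [(hd z).deriv]
    exact mul_nonneg hz.le (sinh_nonneg_iff.2 hz.le)
  have := hmono self_mem_Ici hy hy
  simp only [cosh_zero, mul_one, sinh_zero, sub_zero] at this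
  linarith

theorem abs_exp_neg_div_sub_le {α : ℝ} (hα : 0 < α) :
    |exp (-α) / (1 - exp (-α)) ^ 2 - 1 / α ^ 2| ≤ 1 := by
  obtain ⟨y, rfl⟩ : ∃ y, α = 2 * y := ⟨α / 2, by ring⟩
  have hy : 0 < y := by linarith
  have hs : 0 < sinh y := sinh_pos_iff.2 hy
  have h1 : exp (-(2 * y)) / (1 - exp (-(2 * y))) ^ 2 = 1 / (4 * sinh y ^ 2) := by
    have e1 : exp (-(2 * y)) = exp (-y) ^ 2 := by rw [← exp_nat_mul]; push_cast; ring_nf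
    have e2 : 1 - exp (-(2 * y)) = 2 * exp (-y) * sinh y := by
      rw [sinh_eq, e1]
      have : exp (-y) * exp y = 1 := by rw [← exp_add]; simp
      linear_combination -this
    rw [e2, e1]
    have := exp_pos (-y)
    field_simp
    ring
  have h2 : y ≤ sinh y := self_le_sinh_iff.2 hy.le
  have h3 := sinh_le_mul_cosh hy.le
  have h4 : sinh y ^ 2 ≤ y ^ 2 * (1 + sinh y ^ 2) := by
    have := pow_le_pow_left₀ hs.le h3 2
    rwa [mul_pow, cosh_sq'] at this
  rw [h1, abs_le]
  constructor
  · have h5 : 1 / y ^ 2 ≤ (1 + sinh y ^ 2) / sinh y ^ 2 := by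
      rw [div_le_div_iff₀ (by positivity) (by positivity)]
      linarith
    have h6 : (1 + sinh y ^ 2) / sinh y ^ 2 = 1 / sinh y ^ 2 + 1 := by field_simp
    have h7 : 1 / (4 * sinh y ^ 2) = 1 / sinh y ^ 2 / 4 := by field_simp
    have h8 : 1 / (2 * y) ^ 2 = 1 / y ^ 2 / 4 := by field_simp; norm_num
    linarith
  · have h5 : 1 / (4 * sinh y ^ 2) ≤ 1 / (2 * y) ^ 2 := by
      rw [mul_pow]
      gcongr
      norm_num
    linarith

theorem exp_neg_div_le {α : ℝ} (hα : 1 / 2 ≤ α) :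
    exp (-α) / (1 - exp (-α)) ^ 2 ≤ 9 * exp (-α) := by
  have h1 : exp (-α) ≤ 2 / 3 := by
    rw [exp_neg, inv_le_comm₀ (exp_pos _) (by norm_num)]
    linarith [add_one_le_exp α]
  have h2 : 1 / 9 ≤ (1 - exp (-α)) ^ 2 := by nlinarith
  rw [div_le_iff₀ (by positivity)]
  nlinarith [exp_pos (-α)]

theorem one_sub_tanh_le (z : ℝ) : 1 - tanh z ≤ 2 * exp (-(2 * z)) := by
  have h : 1 - tanh z = exp (-z) / cosh z := by
    rw [tanh_eq_sinh_div_cosh, ← cosh_sub_sinh]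
    field_simp [(cosh_pos z).ne']
  rw [h, div_le_iff₀ (cosh_pos z), cosh_eq]
  have e1 : exp (-(2 * z)) * exp z = exp (-z) := by rw [← exp_add]; ring_nf
  nlinarith [mul_pos (exp_pos (-(2 * z))) (exp_pos (-z))]

theorem continuous_real_tanh : Continuous tanh := by
  have : tanh = fun z => sinh z / cosh z := funext tanh_eq_sinh_div_cosh
  rw [this]
  exact continuous_sinh.div continuous_cosh fun z => (cosh_pos z).ne'

theorem integrableOn_rpow_mul_one_sub_tanh {s b : ℝ} (hs : -1 < s) (hb : 0 < b) :
    IntegrableOn (fun t : ℝ => t ^ s * (1 - tanh (t * b / 2))) (Ioi 0) := by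
  refine Integrable.mono' ((integrableOn_rpow_mul_exp_neg_mul hs hb).const_mul 2) ?_ ?_
  · have := continuous_real_tanh
    exact (by fun_prop : Measurable fun t : ℝ => t ^ s).aestronglyMeasurable.mul
      (by fun_prop : Continuous fun t : ℝ => 1 - tanh (t * b / 2)).aestronglyMeasurable
  · filter_upwards [ae_restrict_mem measurableSet_Ioi] with t ht
    have ht' : 0 < t := ht
    rw [norm_of_nonneg (mul_nonneg (by positivity) (sub_nonneg.2 (tanh_lt_one _).le))]
    have := mul_le_mul_of_nonneg_left (one_sub_tanh_le (t * b / 2)) (by positivity : 0 ≤ t ^ s)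
    rw [show -(2 * (t * b / 2)) = -b * t by ring] at this
    linarith

theorem integral_rpow_mul_one_sub_tanh_pos {s : ℝ} (hs : -1 < s) :
    0 < ∫ t in Ioi (0 : ℝ), t ^ s * (1 - tanh (t / 2)) := by
  have hi : IntegrableOn (fun t : ℝ => t ^ s * (1 - tanh (t / 2))) (Ioi 0) := by
    simpa using integrableOn_rpow_mul_one_sub_tanh hs one_pos
  have hpos : ∀ t ∈ Ioi (0 : ℝ), 0 < t ^ s * (1 - tanh (t / 2)) := fun t ht =>
    mul_pos (rpow_pos_of_pos ht _) (sub_pos.2 (tanh_lt_one _))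
  rw [setIntegral_pos_iff_support_of_nonneg_ae
    ((ae_restrict_mem measurableSet_Ioi).mono fun t ht => (hpos t ht).le) hi,
    inter_eq_right.2 (show Ioi (0 : ℝ) ⊆ Function.support fun t : ℝ => t ^ s * (1 - tanh (t / 2))
      from fun t ht => (hpos t ht).ne')]
  simp

theorem integral_rpow_mul_one_sub_tanh_mul (s : ℝ) {h : ℝ} (hh : 0 < h) :
    ∫ t in Ioi (0 : ℝ), t ^ s * (1 - tanh (t * h / 2))
      = h ^ (-(s + 1)) * ∫ t in Ioi (0 : ℝ), t ^ s * (1 - tanh (t / 2)) := by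
  have := integral_comp_mul_left_Ioi (fun t : ℝ => t ^ s * (1 - tanh (t / 2))) 0 hh
  rw [mul_zero, smul_eq_mul] at this
  rw [neg_add, rpow_add hh, rpow_neg_one, mul_assoc, ← this, ← integral_const_mul]
  refine setIntegral_congr_fun measurableSet_Ioi fun t ht => ?_
  rw [mul_rpow hh.le (le_of_lt ht), ← mul_assoc, ← mul_assoc, ← rpow_add hh, mul_comm h t]
  simp

theorem isBigO_integral_sub_of_ae_eq {p c : ℝ} (hp : 3 < p) (hc : 0 < c) {μ : ℝ → ℝ}
    (hμ : IntegrableOn (fun α => μ α * exp (-α)) (Ioi 0))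
    (hμc : ∀ᵐ α : ℝ, α ∈ Ioo (0 : ℝ) (1 / 2) → μ α = c * α ^ (p - 2)) :
    (fun h : ℝ => (∫ α in Ioi (0 : ℝ),
        μ α * (exp (-α) / (1 - exp (-α)) ^ 2) * (1 - tanh (α * h / 2)))
        - c * (h ^ (-(p - 3)) * ∫ α in Ioi (0 : ℝ), α ^ (p - 4) * (1 - tanh (α / 2))))
      =O[atTop] fun h : ℝ => h ^ (1 - p) := by
  set f : ℝ → ℝ := fun α => μ α - c * α ^ (p - 2) with hf
  have hfi : IntegrableOn (fun α => f α * exp (-α)) (Ioi 0) := by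
    have := (integrableOn_rpow_mul_exp_neg_mul (s := p - 2) (by linarith) one_pos).const_mul c
    refine (hμ.sub this).congr (ae_of_all _ fun α => ?_)
    simp [hf, sub_mul, mul_assoc]
  have hfm : AEStronglyMeasurable f (volume.restrict (Ioi 0)) := by
    have : AEStronglyMeasurable (fun α => (f α * exp (-α)) * exp α) (volume.restrict (Ioi 0)) :=
      hfi.aestronglyMeasurable.mul (by fun_prop)
    refine this.congr (ae_of_all _ fun α => ?_)
    simp [mul_assoc, ← exp_add]
  set w : ℝ → ℝ := fun α => exp (-α) / (1 - exp (-α)) ^ 2 with hw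
  have hwm : Measurable w := by fun_prop
  have htc := continuous_real_tanh
  have hT (z : ℝ) : 0 ≤ 1 - tanh z := sub_nonneg.2 (tanh_lt_one z).le
  set M := ∫ α in Ioi (0 : ℝ), ‖f α * exp (-α)‖ with hM
  have key : ∀ h : ℝ, 0 < h → ‖(∫ α in Ioi (0 : ℝ), μ α * w α * (1 - tanh (α * h / 2)))
      - c * (h ^ (-(p - 3)) * ∫ α in Ioi (0 : ℝ), α ^ (p - 4) * (1 - tanh (α / 2)))‖
      ≤ 18 * M * exp (-(1 / 2) * h) + 2 * c * Gamma (p - 1) * h ^ (1 - p) := by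
    intro h hh
    have hTm : Measurable fun α : ℝ => 1 - tanh (α * h / 2) :=
      (by fun_prop : Continuous fun α : ℝ => 1 - tanh (α * h / 2)).measurable
    have b1 : ∀ᵐ α ∂(volume.restrict (Ioi (0 : ℝ))), ‖f α * w α * (1 - tanh (α * h / 2))‖
        ≤ 18 * exp (-(1 / 2) * h) * ‖f α * exp (-α)‖ := by
      filter_upwards [ae_restrict_of_ae hμc, ae_restrict_mem measurableSet_Ioi] with α h1 h2
      rcases lt_or_ge α (1 / 2) with h3 | h3
      · have : f α = 0 := by simp [hf, h1 ⟨h2, h3⟩]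
        simp [this]
      · have e1 : 1 - tanh (α * h / 2) ≤ 2 * exp (-(1 / 2) * h) :=
          (one_sub_tanh_le _).trans (by gcongr; nlinarith)
        have e2 := exp_neg_div_le h3
        have e3 : 0 ≤ w α := by positivity
        rw [norm_mul, norm_mul, norm_mul, norm_of_nonneg e3, norm_of_nonneg (hT _),
          norm_of_nonneg (exp_nonneg _)]
        calc _ ≤ ‖f α‖ * (9 * exp (-α)) * (2 * exp (-(1 / 2) * h)) := by gcongr; exact hT _
          _ = _ := by ring
    have i1 : IntegrableOn (fun α => f α * w α * (1 - tanh (α * h / 2))) (Ioi 0) :=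
      Integrable.mono' (hfi.norm.const_mul _)
        ((hfm.mul hwm.aestronglyMeasurable).mul hTm.aestronglyMeasurable) b1
    have b2 : ∀ᵐ α ∂(volume.restrict (Ioi (0 : ℝ))),
        ‖c * α ^ (p - 2) * (w α - 1 / α ^ 2) * (1 - tanh (α * h / 2))‖
        ≤ 2 * c * (α ^ (p - 2) * exp (-h * α)) := by
      filter_upwards [ae_restrict_mem measurableSet_Ioi] with α h2
      have h2' : 0 < α := h2
      have e1 := one_sub_tanh_le (α * h / 2)
      rw [show -(2 * (α * h / 2)) = -h * α by ring] at e1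
      have e2 : ‖w α - 1 / α ^ 2‖ ≤ 1 := abs_exp_neg_div_sub_le h2
      rw [norm_mul, norm_mul, norm_of_nonneg (by positivity), norm_of_nonneg (hT _)]
      calc _ ≤ c * α ^ (p - 2) * 1 * (2 * exp (-h * α)) := by gcongr; exact hT _
        _ = _ := by ring
    have g2 := (integrableOn_rpow_mul_exp_neg_mul (s := p - 2) (by linarith) hh).const_mul (2 * c)
    have i2 : IntegrableOn
        (fun α => c * α ^ (p - 2) * (w α - 1 / α ^ 2) * (1 - tanh (α * h / 2))) (Ioi 0) :=
      Integrable.mono' g2 (by fun_prop (disch := assumption)) b2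
    have i12 : IntegrableOn (fun α => f α * w α * (1 - tanh (α * h / 2))
        + c * α ^ (p - 2) * (w α - 1 / α ^ 2) * (1 - tanh (α * h / 2))) (Ioi 0) := i1.add i2
    have i3 : IntegrableOn (fun α => c * (α ^ (p - 4) * (1 - tanh (α * h / 2)))) (Ioi 0) :=
      (integrableOn_rpow_mul_one_sub_tanh (by linarith) hh).const_mul c
    have hsplit : ∫ α in Ioi (0 : ℝ), μ α * w α * (1 - tanh (α * h / 2))
        = (∫ α in Ioi (0 : ℝ), f α * w α * (1 - tanh (α * h / 2)))
        + (∫ α in Ioi (0 : ℝ), c * α ^ (p - 2) * (w α - 1 / α ^ 2) * (1 - tanh (α * h / 2)))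
        + ∫ α in Ioi (0 : ℝ), c * (α ^ (p - 4) * (1 - tanh (α * h / 2))) := by
      rw [← integral_add i1 i2, ← integral_add i12 i3]
      refine setIntegral_congr_fun measurableSet_Ioi fun α hα => ?_
      have hα' : 0 < α := hα
      have e : α ^ (p - 2) = α ^ (p - 4) * α ^ 2 := by
        rw [← rpow_natCast, ← rpow_add hα']
        norm_num
        ring_nf
      simp only [hf, e]
      field_simp
      ring
    rw [hsplit, integral_const_mul c, integral_rpow_mul_one_sub_tanh_mul _ hh,
      show -(p - 4 + 1) = -(p - 3) by ring, add_sub_cancel_right]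
    refine (norm_add_le _ _).trans (add_le_add ?_ ?_)
    · refine (norm_integral_le_of_norm_le (hfi.norm.const_mul _) b1).trans (le_of_eq ?_)
      rw [integral_const_mul]
      ring
    · refine (norm_integral_le_of_norm_le g2 b2).trans (le_of_eq ?_)
      have := integral_rpow_mul_exp_neg_mul_Ioi (a := p - 1) (by linarith) hh
      rw [one_div, inv_rpow hh.le, ← rpow_neg hh.le, neg_sub, show p - 1 - 1 = p - 2 by ring] at this
      simp only [neg_mul]
      rw [integral_const_mul, this]
      ring
  have hO : (fun h : ℝ => 18 * M * exp (-(1 / 2) * h) + 2 * c * Gamma (p - 1) * h ^ (1 - p))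
      =O[atTop] fun h : ℝ => h ^ (1 - p) :=
    ((isLittleO_exp_neg_mul_rpow_atTop (by norm_num) _).isBigO.const_mul_left _).add
      ((isBigO_refl _ _).const_mul_left _)
  refine IsBigO.trans (IsBigO.of_bound 1 ?_) hO
  filter_upwards [eventually_gt_atTop 0] with h hh
  rw [one_mul]
  exact (key h hh).trans (le_abs_self _)

/-- asymptotic expansion of the one-dimensional striped energy per site:
if `μ_v` is the inverse Laplace transform of `v_∞(x) = Σ_{y∈ℤ}(x²+y²)^{-p/2}`, then
`e_s(h) = τ/h + (2/h)∫₀^∞ μ_v(α) e^{-α}/(1-e^{-α})² (1 - tanh(αh/2)) dα`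
satisfies `e_s(h) = τ/h + A_p/h^{p-2} + O(h^{-p})` as `h → ∞`, for some `A_p > 0`. -/
theorem striped_energy_asymptotics (p τ : ℝ) (hp : 4 < p) (μ : ℝ → ℝ)
    (hμ : ∀ x : ℝ, 0 < x →
      (∑' y : ℤ, ((x ^ 2 + (y : ℝ) ^ 2) ^ (-(p / 2))))
        = ∫ α in Set.Ioi (0 : ℝ), μ α * Real.exp (-α * x)) :
    ∃ A : ℝ, 0 < A ∧
      (fun h : ℝ =>
          (τ / h + (2 / h) * ∫ α in Set.Ioi (0 : ℝ),
              μ α * (Real.exp (-α) / (1 - Real.exp (-α)) ^ 2) * (1 - Real.tanh (α * h / 2)))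
          - (τ / h + A / h ^ (p - 2)))
        =O[atTop] fun h : ℝ => h ^ (-p) := by
  obtain ⟨c, K, hc, hK⟩ := exists_abs_tsum_sub_laplace_le (p := p) (by linarith)
  have hμi (x : ℝ) (hx : 0 < x) : IntegrableOn (fun α => μ α * exp (-α * x)) (Ioi 0) := by
    by_contra h
    have h1 := hμ x hx
    rw [integral_undef h] at h1
    exact (tsum_add_int_sq_rpow_pos (by linarith) hx).ne' h1
  have hci (x : ℝ) (hx : 0 < x) :
      IntegrableOn (fun α => c * (α ^ (p - 2) * exp (-α * x))) (Ioi 0) := by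
    refine IntegrableOn.congr_fun
      ((integrableOn_rpow_mul_exp_neg_mul (s := p - 2) (by linarith) hx).const_mul c)
      (fun α _ => ?_) measurableSet_Ioi
    ring_nf
  have hfe (x : ℝ) : (fun α => (μ α - c * α ^ (p - 2)) * exp (-α * x))
      = fun α => μ α * exp (-α * x) - c * (α ^ (p - 2) * exp (-α * x)) := by
    ext α
    ring
  have hzero : ∀ᵐ α : ℝ, α ∈ Ioo (0 : ℝ) (1 / 2) → μ α - c * α ^ (p - 2) = 0 := by
    refine ae_eq_zero_of_laplace_le (f := fun α => μ α - c * α ^ (p - 2)) (K := K)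
      (fun x hx => ?_) fun x hx => ?_
    · simp only [hfe]
      exact (hμi x hx).sub (hci x hx)
    · have hx0 : 0 < x := one_pos.trans_le hx
      simp only [hfe]
      rw [integral_sub (hμi x hx0) (hci x hx0), integral_const_mul, ← hμ x hx0]
      exact hK x hx
  set B := ∫ α in Ioi (0 : ℝ), α ^ (p - 4) * (1 - tanh (α / 2)) with hB
  have hBpos : 0 < B := integral_rpow_mul_one_sub_tanh_pos (by linarith)
  refine ⟨2 * c * B, by positivity, ?_⟩
  have hO := isBigO_integral_sub_of_ae_eq (p := p) (by linarith) hc (by simpa using hμi 1 one_pos)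
    (hzero.mono fun α h1 h2 => sub_eq_zero.1 (h1 h2))
  have h1 : (fun h : ℝ => 2 * h⁻¹) =O[atTop] fun h : ℝ => h⁻¹ :=
    (isBigO_refl _ _).const_mul_left 2
  refine (h1.mul hO).congr' ?_ ?_
  · filter_upwards [eventually_gt_atTop 0] with h hh
    have e : 1 / h ^ (p - 2) = h⁻¹ * h ^ (-(p - 3)) := by
      rw [← rpow_neg_one, ← rpow_add hh, one_div, ← rpow_neg hh.le]
      ring_nf
    rw [div_eq_mul_one_div (2 * c * B), e, ← hB]
    ring
  · filter_upwards [eventually_gt_atTop 0] with h hh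
    rw [← rpow_neg_one, ← rpow_add hh]
    ring_nf
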